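/- arXiv:2303.02183 — 3 statements merged into one kernel-verified Lean document; each statement's English description precedes it below -/
import Mathlib

section
/- Geodesics of WOP: let μ₀, μ₁ ∈ M(ℝ^d) with m_{μ₀} + m_{μ₁} > 0, set m_t := (1−t)m_{μ₀} + t·m_{μ₁} and λ_t := t·m_{μ₁}/((1−t)m_{μ₀} + t·m_{μ₁}) for t ∈ [0,1], and let (μ̂_s)_{s∈[0,1]} be a constant-speed W₂-geodesic from μ̄₀ to μ̄₁ induced by an optimal coupling (i.e. μ̂_s = P_s#π̃ with P_s(x,y) = (1−s)x + s y and π̃ an optimal coupling of μ̄₀ and μ̄₁ for the quadratic cost). Then the curve μ_t := m_t·μ̂_{λ_t} is a constant-speed geodesic in (M(ℝ^d), WOP): WOP(μ_s, μ_t) = |t−s|·WOP(μ₀, μ₁) for all s, t ∈ [0,1]. In particular, this geodesic does not depend on the reference point x₀. -/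
open MeasureTheory

noncomputable section

abbrev Euc (d : ℕ) := EuclideanSpace ℝ (Fin d)

variable {d : ℕ}

/-- Total mass of a measure. -/
def mass (μ : Measure (Euc d)) : ℝ := (μ Set.univ).toReal

/-- Second moment centered at `x₀`. -/
def sndMoment (x₀ : Euc d) (μ : Measure (Euc d)) : ℝ := ∫ x, ‖x - x₀‖ ^ 2 ∂μ

/-- `μ ∈ M(ℝ^d)`: finite positive measure with finite second moment. -/
def MemM (μ : Measure (Euc d)) : Prop :=
  IsFiniteMeasure μ ∧ Integrable (fun x => ‖x‖ ^ 2) μ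

/-- `μ ∈ P₂(ℝ^d)`: probability measure with finite second moment. -/
def MemP2 (μ : Measure (Euc d)) : Prop :=
  IsProbabilityMeasure μ ∧ Integrable (fun x => ‖x‖ ^ 2) μ

/-- Squared 2-Wasserstein distance, as an infimum over couplings. -/
def W2sq (μ ν : Measure (Euc d)) : ℝ :=
  sInf { r : ℝ | ∃ π : Measure (Euc d × Euc d),
    π.map Prod.fst = μ ∧ π.map Prod.snd = ν ∧ r = ∫ p, ‖p.1 - p.2‖ ^ 2 ∂π }

/-- 2-Wasserstein distance. -/
def W2 (μ ν : Measure (Euc d)) : ℝ := Real.sqrt (W2sq μ ν)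

/-- The dilation `T_a(x) = a (x - x₀) + x₀`. -/
def dil (x₀ : Euc d) (a : ℝ) (x : Euc d) : Euc d := a • (x - x₀) + x₀

/-- Normalization `μ̄` of `μ`, with the convention `μ̄ = δ_{x₀}` for the null measure. -/
def nm (x₀ : Euc d) (μ : Measure (Euc d)) : Measure (Euc d) :=
  if μ Set.univ = 0 then Measure.dirac x₀ else (μ Set.univ)⁻¹ • μ

/-- Squared WOP metric with reference point `x₀`. -/
def WOP2 (x₀ : Euc d) (μ ν : Measure (Euc d)) : ℝ :=
  (mass μ - mass ν) ^ 2 +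
    W2sq ((nm x₀ μ).map (dil x₀ (mass μ))) ((nm x₀ ν).map (dil x₀ (mass ν)))

/-- The WOP metric with reference point `x₀`. -/
def WOP (x₀ : Euc d) (μ ν : Measure (Euc d)) : ℝ := Real.sqrt (WOP2 x₀ μ ν)


/-- The candidate geodesic `μ_t = m_t · μ̂_{λ_t}` built from an optimal coupling `π`
of the normalized measures: `μ̂_s = P_s # π` with `P_s(x,y) = (1-s)x + s y`,
`m_t = (1-t) m_{μ₀} + t m_{μ₁}` and `λ_t = t m_{μ₁} / m_t`. -/
def geoCurve (μ₀ μ₁ : Measure (Euc d)) (π : Measure (Euc d × Euc d)) (t : ℝ) :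
    Measure (Euc d) :=
  ENNReal.ofReal ((1 - t) * mass μ₀ + t * mass μ₁) •
    π.map (fun p =>
      (1 - t * mass μ₁ / ((1 - t) * mass μ₀ + t * mass μ₁)) • p.1
        + (t * mass μ₁ / ((1 - t) * mass μ₀ + t * mass μ₁)) • p.2)

open ProbabilityTheory in
/-- Two couplings sharing the marginal of the middle coordinate can be glued together. -/
theorem exists_gluing {X Y Z : Type*} [MeasurableSpace X] [MeasurableSpace Y] [MeasurableSpace Z]
    [StandardBorelSpace X] [Nonempty X] [StandardBorelSpace Z] [Nonempty Z]
    (π : Measure (X × Y)) (γ : Measure (Y × Z)) [IsFiniteMeasure π] [IsFiniteMeasure γ]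
    (h : π.map Prod.snd = γ.map Prod.fst) :
    ∃ σ : Measure (Y × X × Z),
      σ.map (fun q => (q.2.1, q.1)) = π ∧ σ.map (fun q => (q.1, q.2.2)) = γ := by
  set π' : Measure (Y × X) := π.map Prod.swap with hπ'
  have hfst : π'.fst = γ.fst := by
    rw [Measure.fst, hπ', Measure.map_map measurable_fst measurable_swap]
    exact h
  have hdis : γ.fst ⊗ₘ π'.condKernel = π' := by
    rw [← hfst]
    exact π'.disintegrate _
  refine ⟨γ.fst ⊗ₘ (π'.condKernel ×ₖ γ.condKernel), ?_, ?_⟩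
  · have hmap : (fun q : Y × X × Z => (q.2.1, q.1)) = Prod.swap ∘ Prod.map id Prod.fst := rfl
    rw [hmap, ← Measure.map_map (by fun_prop) (by fun_prop),
      ← Measure.compProd_map measurable_fst, ← Kernel.fst_eq, Kernel.fst_prod, hdis, hπ',
      Measure.map_map measurable_swap measurable_swap]
    simp
  · have hmap : (fun q : Y × X × Z => (q.1, q.2.2)) = Prod.map id Prod.snd := rfl
    rw [hmap, ← Measure.compProd_map measurable_snd, ← Kernel.snd_eq, Kernel.snd_prod]
    exact γ.disintegrate _

theorem MemP2.prob_of_map {Ω : Type*} [MeasurableSpace Ω] {π : Measure Ω} {f : Ω → Euc d}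
    (hf : Measurable f) (h : MemP2 (π.map f)) : IsProbabilityMeasure π := by
  have := h.1
  exact (Measure.isProbabilityMeasure_map_iff hf.aemeasurable).1 this

theorem MemP2.integrable_comp {Ω : Type*} [MeasurableSpace Ω] {π : Measure Ω} {f : Ω → Euc d}
    (hf : Measurable f) (h : MemP2 (π.map f)) : Integrable (fun ω => ‖f ω‖ ^ 2) π :=
  (integrable_map_measure (by fun_prop) hf.aemeasurable).1 h.2

theorem integrable_norm_sub_sq {Ω : Type*} [MeasurableSpace Ω] {π : Measure Ω} {f g : Ω → Euc d}
    (hf : Measurable f) (hg : Measurable g)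
    (hfi : Integrable (fun ω => ‖f ω‖ ^ 2) π) (hgi : Integrable (fun ω => ‖g ω‖ ^ 2) π) :
    Integrable (fun ω => ‖f ω - g ω‖ ^ 2) π := by
  refine ((hfi.const_mul 2).add (hgi.const_mul 2)).mono' (by fun_prop) (ae_of_all _ fun ω => ?_)
  rw [Real.norm_of_nonneg (by positivity)]
  have h := parallelogram_law_with_norm ℝ (f ω) (g ω)
  simp only [Pi.add_apply]
  nlinarith [mul_self_nonneg ‖f ω + g ω‖]

theorem W2sq_le {μ ν : Measure (Euc d)} {π : Measure (Euc d × Euc d)}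
    (h₁ : π.map Prod.fst = μ) (h₂ : π.map Prod.snd = ν) :
    W2sq μ ν ≤ ∫ p, ‖p.1 - p.2‖ ^ 2 ∂π := by
  refine csInf_le ⟨0, ?_⟩ ⟨π, h₁, h₂, rfl⟩
  rintro r ⟨σ, -, -, rfl⟩
  positivity

theorem le_W2sq {μ ν : Measure (Euc d)} (hμ : MemP2 μ) (hν : MemP2 ν) {c : ℝ}
    (h : ∀ π : Measure (Euc d × Euc d), π.map Prod.fst = μ → π.map Prod.snd = ν →
      c ≤ ∫ p, ‖p.1 - p.2‖ ^ 2 ∂π) :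
    c ≤ W2sq μ ν := by
  have := hμ.1
  have := hν.1
  refine le_csInf ⟨_, μ.prod ν, by simp, by simp, rfl⟩ ?_
  rintro r ⟨π, h₁, h₂, rfl⟩
  exact h π h₁ h₂

theorem W2sq_nonneg (μ ν : Measure (Euc d)) : 0 ≤ W2sq μ ν := by
  refine Real.sInf_nonneg ?_
  rintro r ⟨σ, -, -, rfl⟩
  positivity

theorem norm_add_sq_le_div {E : Type*} [SeminormedAddCommGroup E] (a b : E) {α : ℝ}
    (h₀ : 0 < α) (h₁ : α < 1) :
    ‖a + b‖ ^ 2 ≤ ‖a‖ ^ 2 / α + ‖b‖ ^ 2 / (1 - α) := by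
  have h₂ : 0 < 1 - α := by linarith
  have h : ‖a + b‖ ^ 2 ≤ (‖a‖ + ‖b‖) ^ 2 := by gcongr; exact norm_add_le a b
  refine h.trans ?_
  rw [div_add_div _ _ h₀.ne' h₂.ne', le_div_iff₀ (by positivity)]
  nlinarith [sq_nonneg ((1 - α) * ‖a‖ - α * ‖b‖)]

/-- A weighted form of the triangle inequality for the quadratic Wasserstein distance. -/
theorem W2sq_triangle {μ ν ξ : Measure (Euc d)} (hμ : MemP2 μ) (hν : MemP2 ν) (hξ : MemP2 ξ)
    {α : ℝ} (h₀ : 0 < α) (h₁ : α < 1) :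
    W2sq μ ξ ≤ W2sq μ ν / α + W2sq ν ξ / (1 - α) := by
  have h₂ : 0 < 1 - α := by linarith
  have key : ∀ π : Measure (Euc d × Euc d), π.map Prod.fst = μ → π.map Prod.snd = ν →
      ∀ γ : Measure (Euc d × Euc d), γ.map Prod.fst = ν → γ.map Prod.snd = ξ →
      W2sq μ ξ ≤ (∫ p, ‖p.1 - p.2‖ ^ 2 ∂π) / α + (∫ p, ‖p.1 - p.2‖ ^ 2 ∂γ) / (1 - α) := by
    intro π hπ₁ hπ₂ γ hγ₁ hγ₂
    have := (hπ₁ ▸ hμ : MemP2 (π.map Prod.fst)).prob_of_map measurable_fst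
    have := (hγ₁ ▸ hν : MemP2 (γ.map Prod.fst)).prob_of_map measurable_fst
    obtain ⟨σ, hσπ, hσγ⟩ := exists_gluing π γ (hπ₂.trans hγ₁.symm)
    have hσ₁ : σ.map (fun q => q.2.1) = μ := by
      rw [← hπ₁, ← hσπ, Measure.map_map (by fun_prop) (by fun_prop)]; rfl
    have hσ₂ : σ.map (fun q => q.1) = ν := by
      rw [← hγ₁, ← hσγ, Measure.map_map (by fun_prop) (by fun_prop)]; rfl
    have hσ₃ : σ.map (fun q => q.2.2) = ξ := by
      rw [← hγ₂, ← hσγ, Measure.map_map (by fun_prop) (by fun_prop)]; rfl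
    have i₁ := (hσ₁ ▸ hμ : MemP2 (σ.map fun q => q.2.1)).integrable_comp (by fun_prop)
    have i₂ := (hσ₂ ▸ hν : MemP2 (σ.map fun q => q.1)).integrable_comp (by fun_prop)
    have i₃ := (hσ₃ ▸ hξ : MemP2 (σ.map fun q => q.2.2)).integrable_comp (by fun_prop)
    have i₁₂ := integrable_norm_sub_sq (by fun_prop) (by fun_prop) i₁ i₂
    have i₂₃ := integrable_norm_sub_sq (by fun_prop) (by fun_prop) i₂ i₃
    have i₁₃ := integrable_norm_sub_sq (by fun_prop) (by fun_prop) i₁ i₃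
    have hle : W2sq μ ξ ≤ ∫ q, ‖q.2.1 - q.2.2‖ ^ 2 ∂σ := by
      have := W2sq_le (μ := μ) (ν := ξ) (π := σ.map Prod.snd)
        (by rw [Measure.map_map (by fun_prop) (by fun_prop)]; exact hσ₁)
        (by rw [Measure.map_map (by fun_prop) (by fun_prop)]; exact hσ₃)
      rwa [integral_map (by fun_prop) (by fun_prop)] at this
    refine hle.trans ?_
    rw [← hσπ, ← hσγ, integral_map (by fun_prop) (by fun_prop),
      integral_map (by fun_prop) (by fun_prop), ← integral_div, ← integral_div,
      ← integral_add (i₁₂.div_const _) (i₂₃.div_const _)]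
    refine integral_mono i₁₃ ((i₁₂.div_const _).add (i₂₃.div_const _)) fun q => ?_
    have := norm_add_sq_le_div (q.2.1 - q.1) (q.1 - q.2.2) h₀ h₁
    rwa [sub_add_sub_cancel] at this
  have hπ : ∀ π : Measure (Euc d × Euc d), π.map Prod.fst = μ → π.map Prod.snd = ν →
      W2sq μ ξ ≤ (∫ p, ‖p.1 - p.2‖ ^ 2 ∂π) / α + W2sq ν ξ / (1 - α) := by
    intro π hπ₁ hπ₂
    rw [← sub_le_iff_le_add', le_div_iff₀ h₂]
    refine le_W2sq hν hξ fun γ hγ₁ hγ₂ => ?_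
    rw [← le_div_iff₀ h₂, sub_le_iff_le_add']
    exact key π hπ₁ hπ₂ γ hγ₁ hγ₂
  rw [← sub_le_iff_le_add, le_div_iff₀ h₀]
  refine le_W2sq hμ hν fun π hπ₁ hπ₂ => ?_
  rw [← le_div_iff₀ h₀, sub_le_iff_le_add]
  exact hπ π hπ₁ hπ₂

theorem W2sq_comm (μ ν : Measure (Euc d)) : W2sq μ ν = W2sq ν μ := by
  have key : ∀ μ ν : Measure (Euc d), ∀ r : ℝ,
      (∃ π : Measure (Euc d × Euc d),
        π.map Prod.fst = μ ∧ π.map Prod.snd = ν ∧ r = ∫ p, ‖p.1 - p.2‖ ^ 2 ∂π) →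
      ∃ π : Measure (Euc d × Euc d),
        π.map Prod.fst = ν ∧ π.map Prod.snd = μ ∧ r = ∫ p, ‖p.1 - p.2‖ ^ 2 ∂π := by
    rintro μ ν r ⟨π, h₁, h₂, rfl⟩
    refine ⟨π.map Prod.swap, ?_, ?_, ?_⟩
    · rw [Measure.map_map (by fun_prop) (by fun_prop)]; exact h₂
    · rw [Measure.map_map (by fun_prop) (by fun_prop)]; exact h₁
    · rw [integral_map (by fun_prop) (by fun_prop)]
      simp only [Prod.fst_swap, Prod.snd_swap, norm_sub_rev]
  rw [W2sq, W2sq]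
  congr 1
  ext r
  exact ⟨key μ ν r, key ν μ r⟩

theorem memP2_map {Ω : Type*} [MeasurableSpace Ω] {π : Measure Ω} [IsProbabilityMeasure π]
    {f : Ω → Euc d} (hf : Measurable f) (hfi : Integrable (fun ω => ‖f ω‖ ^ 2) π) :
    MemP2 (π.map f) :=
  ⟨Measure.isProbabilityMeasure_map hf.aemeasurable,
    (integrable_map_measure (by fun_prop) hf.aemeasurable).2 hfi⟩

theorem integrable_norm_smul_add_smul_sq {Ω : Type*} [MeasurableSpace Ω] {π : Measure Ω}
    {f g : Ω → Euc d} (hf : Measurable f) (hg : Measurable g)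
    (hfi : Integrable (fun ω => ‖f ω‖ ^ 2) π) (hgi : Integrable (fun ω => ‖g ω‖ ^ 2) π)
    (a b : ℝ) : Integrable (fun ω => ‖a • f ω + b • g ω‖ ^ 2) π := by
  have hfi' : Integrable (fun ω => ‖a • f ω‖ ^ 2) π := by
    simpa only [norm_smul, mul_pow] using hfi.const_mul (‖a‖ ^ 2)
  have hgi' : Integrable (fun ω => ‖(-b) • g ω‖ ^ 2) π := by
    simpa only [norm_smul, mul_pow] using hgi.const_mul (‖-b‖ ^ 2)
  simpa only [neg_smul, sub_neg_eq_add] using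
    integrable_norm_sub_sq (by fun_prop) (by fun_prop) hfi' hgi'

/-- The displacement interpolation at time `t` induced by a coupling `ρ`. -/
def interp (ρ : Measure (Euc d × Euc d)) (t : ℝ) : Measure (Euc d) :=
  ρ.map fun q => (1 - t) • q.1 + t • q.2

theorem interp_zero (ρ : Measure (Euc d × Euc d)) : interp ρ 0 = ρ.map Prod.fst := by
  simp [interp]

theorem interp_one (ρ : Measure (Euc d × Euc d)) : interp ρ 1 = ρ.map Prod.snd := by
  simp [interp]

theorem memP2_interp {ρ : Measure (Euc d × Euc d)} (h₁ : MemP2 (ρ.map Prod.fst))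
    (h₂ : MemP2 (ρ.map Prod.snd)) (t : ℝ) : MemP2 (interp ρ t) := by
  have := h₁.prob_of_map measurable_fst
  exact memP2_map (by fun_prop) (integrable_norm_smul_add_smul_sq measurable_fst measurable_snd
    (h₁.integrable_comp measurable_fst) (h₂.integrable_comp measurable_snd) _ _)

theorem W2sq_interp_le (ρ : Measure (Euc d × Euc d)) (s t : ℝ) :
    W2sq (interp ρ s) (interp ρ t) ≤ (t - s) ^ 2 * ∫ q, ‖q.1 - q.2‖ ^ 2 ∂ρ := by
  have h := W2sq_le (μ := interp ρ s) (ν := interp ρ t)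
    (π := ρ.map fun q => ((1 - s) • q.1 + s • q.2, (1 - t) • q.1 + t • q.2))
    (by rw [Measure.map_map (by fun_prop) (by fun_prop)]; rfl)
    (by rw [Measure.map_map (by fun_prop) (by fun_prop)]; rfl)
  rw [integral_map (by fun_prop) (by fun_prop)] at h
  refine h.trans_eq ?_
  rw [← integral_const_mul]
  congr with q
  have : (1 - s) • q.1 + s • q.2 - ((1 - t) • q.1 + t • q.2) = (t - s) • (q.1 - q.2) := by
    module
  rw [this, norm_smul, mul_pow, Real.norm_eq_abs, sq_abs]

/-- The displacement interpolation induced by an optimal coupling has constant speed. -/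
theorem W2sq_interp {ρ : Measure (Euc d × Euc d)} (h₁ : MemP2 (ρ.map Prod.fst))
    (h₂ : MemP2 (ρ.map Prod.snd))
    (hopt : (∫ q, ‖q.1 - q.2‖ ^ 2 ∂ρ) = W2sq (ρ.map Prod.fst) (ρ.map Prod.snd))
    {s t : ℝ} (hs : 0 ≤ s) (hst : s ≤ t) (ht : t ≤ 1) :
    W2sq (interp ρ s) (interp ρ t) = (t - s) ^ 2 * W2sq (ρ.map Prod.fst) (ρ.map Prod.snd) := by
  refine le_antisymm (hopt ▸ W2sq_interp_le ρ s t) ?_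
  set W := W2sq (ρ.map Prod.fst) (ρ.map Prod.snd) with hW
  have hP := memP2_interp h₁ h₂
  have hle : ∀ a b, W2sq (interp ρ a) (interp ρ b) ≤ (b - a) ^ 2 * W := fun a b =>
    hopt ▸ W2sq_interp_le ρ a b
  have hW' : W2sq (interp ρ 0) (interp ρ 1) = W := by rw [interp_zero, interp_one]
  rcases hst.eq_or_lt with rfl | hst
  · simpa using W2sq_nonneg _ _
  have hs1 : 0 < 1 - s := by linarith
  have hright : (1 - s) ^ 2 * W ≤ W2sq (interp ρ s) (interp ρ 1) := by
    rcases hs.eq_or_lt with rfl | hs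
    · simp [hW']
    have h := W2sq_triangle (hP 0) (hP s) (hP 1) hs (by linarith)
    have h' : W2sq (interp ρ 0) (interp ρ s) / s ≤ s * W := by
      rw [div_le_iff₀ hs]
      exact (hle 0 s).trans_eq (by ring)
    have h'' : (1 - s) * W ≤ W2sq (interp ρ s) (interp ρ 1) / (1 - s) := by linarith
    rw [le_div_iff₀ hs1] at h''
    linarith
  rcases ht.eq_or_lt with rfl | ht
  · exact hright
  have ht1 : 0 < 1 - t := by linarith
  have hts : 0 < t - s := by linarith
  have h := W2sq_triangle (hP s) (hP t) (hP 1) (α := (t - s) / (1 - s)) (by positivity)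
    (by rw [div_lt_one hs1]; linarith)
  have hα : 1 - (t - s) / (1 - s) = (1 - t) / (1 - s) := by field_simp; ring
  have h' : W2sq (interp ρ t) (interp ρ 1) / ((1 - t) / (1 - s)) ≤ (1 - t) * (1 - s) * W := by
    rw [div_le_iff₀ (by positivity)]
    exact (hle t 1).trans_eq (by field_simp)
  rw [hα] at h
  have h'' : (t - s) * (1 - s) * W ≤ W2sq (interp ρ s) (interp ρ t) / ((t - s) / (1 - s)) := by
    linarith
  rw [le_div_iff₀ (by positivity)] at h''
  exact h''.trans_eq' (by field_simp)

theorem norm_dil_sub_dil_sq (y : Euc d) (a b : ℝ) (u v : Euc d) :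
    ‖dil y a u - dil y b v‖ ^ 2 =
      a * b * ‖u - v‖ ^ 2 + (a ^ 2 - a * b) * ‖u - y‖ ^ 2 + (b ^ 2 - a * b) * ‖v - y‖ ^ 2 := by
  have h₁ : dil y a u - dil y b v = a • (u - y) - b • (v - y) := by simp only [dil]; abel
  have h₂ : u - v = (u - y) - (v - y) := by abel
  rw [h₁, h₂]
  generalize u - y = p
  generalize v - y = q
  rw [norm_sub_sq_real, norm_sub_sq_real, norm_smul, norm_smul, real_inner_smul_left,
    real_inner_smul_right, mul_pow, mul_pow, Real.norm_eq_abs, Real.norm_eq_abs, sq_abs, sq_abs]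
  ring

@[fun_prop]
theorem measurable_dil (y : Euc d) (a : ℝ) : Measurable (dil y a) := by
  unfold dil
  fun_prop

theorem dil_dil_inv (y : Euc d) {a : ℝ} (ha : a ≠ 0) (x : Euc d) : dil y a⁻¹ (dil y a x) = x := by
  simp [dil, smul_smul, ha]

theorem dil_inv_dil (y : Euc d) {a : ℝ} (ha : a ≠ 0) (x : Euc d) : dil y a (dil y a⁻¹ x) = x := by
  simp [dil, smul_smul, ha]

theorem integral_norm_dil_sub_dil_sq (y : Euc d) (a b : ℝ) {π : Measure (Euc d × Euc d)}
    (h₁ : MemP2 (π.map Prod.fst)) (h₂ : MemP2 (π.map Prod.snd)) :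
    ∫ p, ‖dil y a p.1 - dil y b p.2‖ ^ 2 ∂π =
      a * b * (∫ p, ‖p.1 - p.2‖ ^ 2 ∂π) + (a ^ 2 - a * b) * (∫ x, ‖x - y‖ ^ 2 ∂π.map Prod.fst) +
        (b ^ 2 - a * b) * ∫ x, ‖x - y‖ ^ 2 ∂π.map Prod.snd := by
  have := h₁.prob_of_map measurable_fst
  have i₁ := h₁.integrable_comp measurable_fst
  have i₂ := h₂.integrable_comp measurable_snd
  have i₁₂ := integrable_norm_sub_sq measurable_fst measurable_snd i₁ i₂
  have i₁y := integrable_norm_sub_sq (g := fun _ => y) measurable_fst measurable_const i₁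
    (integrable_const _)
  have i₂y := integrable_norm_sub_sq (g := fun _ => y) measurable_snd measurable_const i₂
    (integrable_const _)
  rw [integral_map (by fun_prop) (by fun_prop), integral_map (by fun_prop) (by fun_prop),
    ← integral_const_mul, ← integral_const_mul, ← integral_const_mul, ← integral_add, ← integral_add]
  · simp only [norm_dil_sub_dil_sq]
  all_goals fun_prop

theorem MemP2.map_dil {Ω : Type*} [MeasurableSpace Ω] {π : Measure Ω} {f : Ω → Euc d}
    (hf : Measurable f) (h : MemP2 (π.map f)) (y : Euc d) (a : ℝ) :
    MemP2 (π.map fun ω => dil y a (f ω)) := by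
  have := h.prob_of_map hf
  refine memP2_map (by fun_prop) ?_
  have := integrable_norm_smul_add_smul_sq (g := fun _ => (1 - a) • y) hf measurable_const
    (h.integrable_comp hf) (integrable_const _) a 1
  refine this.congr (ae_of_all _ fun ω => ?_)
  have : a • f ω + (1 : ℝ) • (1 - a) • y = dil y a (f ω) := by rw [dil]; module
  simp only [this]

theorem integral_norm_sub_sq_of_fst_eq_dirac {γ : Measure (Euc d × Euc d)} {y : Euc d}
    (h : γ.map Prod.fst = Measure.dirac y) :
    ∫ p, ‖p.1 - p.2‖ ^ 2 ∂γ = ∫ v, ‖y - v‖ ^ 2 ∂γ.map Prod.snd := by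
  have hae : ∀ᵐ p ∂γ, p.1 = y := by
    refine ae_of_ae_map (p := fun x => x = y) measurable_fst.aemeasurable ?_
    rw [h, ae_dirac_eq]
    rfl
  rw [integral_map (by fun_prop) (by fun_prop)]
  exact integral_congr_ae (hae.mono fun p hp => by simp only [hp])

theorem integral_norm_sub_sq_of_snd_eq_dirac {γ : Measure (Euc d × Euc d)} {y : Euc d}
    (h : γ.map Prod.snd = Measure.dirac y) :
    ∫ p, ‖p.1 - p.2‖ ^ 2 ∂γ = ∫ u, ‖u - y‖ ^ 2 ∂γ.map Prod.fst := by
  have hae : ∀ᵐ p ∂γ, p.2 = y := by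
    refine ae_of_ae_map (p := fun x => x = y) measurable_snd.aemeasurable ?_
    rw [h, ae_dirac_eq]
    rfl
  rw [integral_map (by fun_prop) (by fun_prop)]
  exact integral_congr_ae (hae.mono fun p hp => by simp only [hp])

theorem map_dil_zero {Ω : Type*} [MeasurableSpace Ω] {π : Measure Ω} [IsProbabilityMeasure π]
    (y : Euc d) (f : Ω → Euc d) : (π.map fun ω => dil y 0 (f ω)) = Measure.dirac y := by
  simp [dil]

/-- Dilating both coordinates about the same point preserves optimality of a coupling. -/
theorem integral_map_dil_eq_W2sq {π : Measure (Euc d × Euc d)} (h₁ : MemP2 (π.map Prod.fst))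
    (h₂ : MemP2 (π.map Prod.snd))
    (hopt : (∫ q, ‖q.1 - q.2‖ ^ 2 ∂π) = W2sq (π.map Prod.fst) (π.map Prod.snd))
    (y : Euc d) {a b : ℝ} (ha : 0 ≤ a) (hb : 0 ≤ b) :
    (∫ q, ‖q.1 - q.2‖ ^ 2 ∂π.map fun p => (dil y a p.1, dil y b p.2)) =
      W2sq (π.map fun p => dil y a p.1) (π.map fun p => dil y b p.2) := by
  have := h₁.prob_of_map measurable_fst
  set ρ := π.map fun p => (dil y a p.1, dil y b p.2) with hρ
  have hρ₁ : ρ.map Prod.fst = π.map fun p => dil y a p.1 := by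
    rw [hρ, Measure.map_map (by fun_prop) (by fun_prop)]; rfl
  have hρ₂ : ρ.map Prod.snd = π.map fun p => dil y b p.2 := by
    rw [hρ, Measure.map_map (by fun_prop) (by fun_prop)]; rfl
  refine le_antisymm (le_W2sq (h₁.map_dil measurable_fst y a) (h₂.map_dil measurable_snd y b)
    fun γ hγ₁ hγ₂ => ?_) (W2sq_le hρ₁ hρ₂)
  rcases ha.eq_or_lt with rfl | ha
  · rw [map_dil_zero] at hρ₁ hγ₁
    rw [integral_norm_sub_sq_of_fst_eq_dirac hρ₁, integral_norm_sub_sq_of_fst_eq_dirac hγ₁, hρ₂,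
      hγ₂]
  rcases hb.eq_or_lt with rfl | hb
  · rw [map_dil_zero] at hρ₂ hγ₂
    rw [integral_norm_sub_sq_of_snd_eq_dirac hρ₂, integral_norm_sub_sq_of_snd_eq_dirac hγ₂, hρ₁,
      hγ₁]
  set σ := γ.map fun p => (dil y a⁻¹ p.1, dil y b⁻¹ p.2) with hσ
  have hσ₁ : σ.map Prod.fst = π.map Prod.fst := by
    have : σ.map Prod.fst = (γ.map Prod.fst).map (dil y a⁻¹) := by
      rw [hσ, Measure.map_map (by fun_prop) (by fun_prop),
        Measure.map_map (by fun_prop) (by fun_prop)]; rfl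
    rw [this, hγ₁, Measure.map_map (by fun_prop) (by fun_prop)]
    congr 1
    exact funext fun p => dil_dil_inv y ha.ne' p.1
  have hσ₂ : σ.map Prod.snd = π.map Prod.snd := by
    have : σ.map Prod.snd = (γ.map Prod.snd).map (dil y b⁻¹) := by
      rw [hσ, Measure.map_map (by fun_prop) (by fun_prop),
        Measure.map_map (by fun_prop) (by fun_prop)]; rfl
    rw [this, hγ₂, Measure.map_map (by fun_prop) (by fun_prop)]
    congr 1
    exact funext fun p => dil_dil_inv y hb.ne' p.2
  have hγ : ∫ p, ‖p.1 - p.2‖ ^ 2 ∂γ = ∫ p, ‖dil y a p.1 - dil y b p.2‖ ^ 2 ∂σ := by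
    rw [hσ, integral_map (by fun_prop) (by fun_prop)]
    simp only [dil_inv_dil y ha.ne', dil_inv_dil y hb.ne']
  rw [hγ, hρ, integral_map (by fun_prop) (by fun_prop), integral_norm_dil_sub_dil_sq y a b h₁ h₂,
    integral_norm_dil_sub_dil_sq y a b (hσ₁ ▸ h₁) (hσ₂ ▸ h₂), hσ₁, hσ₂, hopt]
  gcongr
  exact W2sq_le hσ₁ hσ₂

theorem mass_nonneg (μ : Measure (Euc d)) : 0 ≤ mass μ := ENNReal.toReal_nonneg

theorem mass_eq_zero_iff {μ : Measure (Euc d)} [IsFiniteMeasure μ] :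
    mass μ = 0 ↔ μ Set.univ = 0 := by
  simp [mass, ENNReal.toReal_eq_zero_iff]

theorem MemM.memP2_nm {μ : Measure (Euc d)} (h : MemM μ) (x₀ : Euc d) : MemP2 (nm x₀ μ) := by
  have := h.1
  unfold nm
  split_ifs with h₀
  · exact ⟨inferInstance, integrable_dirac (by simp)⟩
  · refine ⟨⟨?_⟩, h.2.smul_measure (by simpa using h₀)⟩
    rw [Measure.smul_apply, smul_eq_mul, ENNReal.inv_mul_cancel h₀ (measure_ne_top _ _)]

theorem map_dil_mass_nm (x y : Euc d) {μ : Measure (Euc d)} [IsFiniteMeasure μ] :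
    (nm x μ).map (dil y (mass μ)) = (nm y μ).map (dil y (mass μ)) := by
  by_cases h₀ : μ Set.univ = 0
  · simp only [nm, if_pos h₀, mass_eq_zero_iff.2 h₀]
    rw [Measure.map_dirac' (measurable_dil _ _), Measure.map_dirac' (measurable_dil _ _)]
    simp [dil]
  · simp only [nm, if_neg h₀]

theorem mass_geoCurve (μ₀ μ₁ : Measure (Euc d)) (π : Measure (Euc d × Euc d))
    [IsProbabilityMeasure π] {t : ℝ} (ht : t ∈ Set.Icc (0 : ℝ) 1) :
    mass (geoCurve μ₀ μ₁ π t) = (1 - t) * mass μ₀ + t * mass μ₁ := by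
  have h₀ : 0 ≤ (1 - t) * mass μ₀ := mul_nonneg (sub_nonneg.2 ht.2) (mass_nonneg _)
  have h₁ : 0 ≤ t * mass μ₁ := mul_nonneg ht.1 (mass_nonneg _)
  rw [mass, geoCurve, Measure.smul_apply, Measure.map_apply (by fun_prop) MeasurableSet.univ]
  simp [ENNReal.toReal_ofReal (add_nonneg h₀ h₁)]

/-- After dilation by its mass, the normalized curve is a displacement interpolation. -/
theorem map_dil_nm_geoCurve (y : Euc d) (μ₀ μ₁ : Measure (Euc d)) (π : Measure (Euc d × Euc d))
    [IsProbabilityMeasure π] {t : ℝ} (ht : t ∈ Set.Icc (0 : ℝ) 1) :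
    (nm y (geoCurve μ₀ μ₁ π t)).map (dil y (mass (geoCurve μ₀ μ₁ π t))) =
      interp (π.map fun p => (dil y (mass μ₀) p.1, dil y (mass μ₁) p.2)) t := by
  have h₀ : 0 ≤ (1 - t) * mass μ₀ := mul_nonneg (sub_nonneg.2 ht.2) (mass_nonneg _)
  have h₁ : 0 ≤ t * mass μ₁ := mul_nonneg ht.1 (mass_nonneg _)
  have huniv : (geoCurve μ₀ μ₁ π t) Set.univ =
      ENNReal.ofReal ((1 - t) * mass μ₀ + t * mass μ₁) := by
    rw [geoCurve, Measure.smul_apply, Measure.map_apply (by fun_prop) MeasurableSet.univ]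
    simp
  rw [mass_geoCurve μ₀ μ₁ π ht, interp, Measure.map_map (by fun_prop) (by fun_prop)]
  have hcomp : ((fun q : Euc d × Euc d => (1 - t) • q.1 + t • q.2) ∘
      fun p : Euc d × Euc d => (dil y (mass μ₀) p.1, dil y (mass μ₁) p.2)) =
      fun p => ((1 - t) * mass μ₀) • (p.1 - y) + (t * mass μ₁) • (p.2 - y) + y := by
    ext1 p
    simp only [Function.comp_apply, dil]
    module
  rw [hcomp]
  rcases (add_nonneg h₀ h₁).eq_or_lt with hm | hm
  · have h₀' : (1 - t) * mass μ₀ = 0 := by linarith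
    have h₁' : t * mass μ₁ = 0 := by linarith
    rw [nm, huniv, h₀', h₁', if_pos (by simp), Measure.map_dirac' (measurable_dil _ _)]
    simp [dil]
  · have hne : ENNReal.ofReal ((1 - t) * mass μ₀ + t * mass μ₁) ≠ 0 := by simpa using hm
    rw [nm, huniv, if_neg hne, geoCurve, smul_smul,
      ENNReal.inv_mul_cancel hne ENNReal.ofReal_ne_top, one_smul,
      Measure.map_map (by fun_prop) (by fun_prop)]
    congr 1
    ext1 p
    set m := (1 - t) * mass μ₀ + t * mass μ₁ with hm'
    have e₁ : m * (t * mass μ₁ / m) = t * mass μ₁ := by field_simp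
    have e₀ : m * (1 - t * mass μ₁ / m) = (1 - t) * mass μ₀ := by rw [mul_sub, e₁, hm']; ring
    clear_value m
    generalize t * mass μ₁ / m = l at e₀ e₁ ⊢
    rw [Function.comp_apply, dil, ← e₀, ← e₁]
    module

theorem WOP_comm (y : Euc d) (μ ν : Measure (Euc d)) : WOP y μ ν = WOP y ν μ := by
  rw [WOP, WOP, WOP2, WOP2, W2sq_comm, ← neg_sub, neg_sq]

/-- geodesics of `WOP`.  The curve `μ_t = m_t · μ̂_{λ_t}` is a
constant-speed geodesic for `WOP`, and this holds for every reference point `y₀`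
(the geodesic does not depend on the reference point). -/
theorem WOP_geodesic (d : ℕ) (x₀ : Euc d) (μ₀ μ₁ : Measure (Euc d))
    (h₀ : MemM μ₀) (h₁ : MemM μ₁) (hm : 0 < mass μ₀ + mass μ₁)
    (π : Measure (Euc d × Euc d))
    (hπ₁ : π.map Prod.fst = nm x₀ μ₀) (hπ₂ : π.map Prod.snd = nm x₀ μ₁)
    (hopt : (∫ p, ‖p.1 - p.2‖ ^ 2 ∂π) = W2sq (nm x₀ μ₀) (nm x₀ μ₁)) :
    ∀ s ∈ Set.Icc (0 : ℝ) 1, ∀ t ∈ Set.Icc (0 : ℝ) 1, ∀ y₀ : Euc d,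
      WOP y₀ (geoCurve μ₀ μ₁ π s) (geoCurve μ₀ μ₁ π t) = |t - s| * WOP y₀ μ₀ μ₁ := by
  have hP₀ : MemP2 (π.map Prod.fst) := hπ₁ ▸ h₀.memP2_nm x₀
  have hP₁ : MemP2 (π.map Prod.snd) := hπ₂ ▸ h₁.memP2_nm x₀
  have := hP₀.prob_of_map measurable_fst
  have := h₀.1
  have := h₁.1
  rw [← hπ₁, ← hπ₂] at hopt
  intro s hs t ht y₀
  wlog hst : s ≤ t generalizing s t
  · rw [WOP_comm, abs_sub_comm]
    exact this t ht s hs (le_of_not_ge hst)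
  set ρ := π.map fun p => (dil y₀ (mass μ₀) p.1, dil y₀ (mass μ₁) p.2) with hρ
  have hρ₁ : ρ.map Prod.fst = π.map fun p => dil y₀ (mass μ₀) p.1 := by
    rw [hρ, Measure.map_map (by fun_prop) (by fun_prop)]; rfl
  have hρ₂ : ρ.map Prod.snd = π.map fun p => dil y₀ (mass μ₁) p.2 := by
    rw [hρ, Measure.map_map (by fun_prop) (by fun_prop)]; rfl
  have hend₀ : (nm y₀ μ₀).map (dil y₀ (mass μ₀)) = ρ.map Prod.fst := by
    rw [← map_dil_mass_nm x₀, ← hπ₁, hρ₁, Measure.map_map (by fun_prop) (by fun_prop)]; rfl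
  have hend₁ : (nm y₀ μ₁).map (dil y₀ (mass μ₁)) = ρ.map Prod.snd := by
    rw [← map_dil_mass_nm x₀, ← hπ₂, hρ₂, Measure.map_map (by fun_prop) (by fun_prop)]; rfl
  have hρopt : (∫ q, ‖q.1 - q.2‖ ^ 2 ∂ρ) = W2sq (ρ.map Prod.fst) (ρ.map Prod.snd) := by
    rw [hρ₁, hρ₂]
    exact integral_map_dil_eq_W2sq hP₀ hP₁ hopt y₀ (mass_nonneg _) (mass_nonneg _)
  have hW := W2sq_interp (hρ₁ ▸ hP₀.map_dil measurable_fst y₀ _)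
    (hρ₂ ▸ hP₁.map_dil measurable_snd y₀ _) hρopt hs.1 hst ht.2
  have hWOP : WOP2 y₀ (geoCurve μ₀ μ₁ π s) (geoCurve μ₀ μ₁ π t) =
      (t - s) ^ 2 * WOP2 y₀ μ₀ μ₁ := by
    rw [WOP2, WOP2, map_dil_nm_geoCurve y₀ μ₀ μ₁ π hs, map_dil_nm_geoCurve y₀ μ₀ μ₁ π ht,
      mass_geoCurve μ₀ μ₁ π hs, mass_geoCurve μ₀ μ₁ π ht, hend₀, hend₁, hW]
    ring
  rw [WOP, WOP, hWOP, Real.sqrt_mul (sq_nonneg _), Real.sqrt_sq_eq_abs]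

end
end

section
/- Impossibility of a bounded extension of W₂: let X ⊆ ℝ^d, let D be a metric on the set of finite positive Borel measures on X with finite second moment, and suppose (i) D(μ,ν) = W₂(μ,ν) for all probability measures μ, ν on X with finite second moment, and (ii) there exists α > 0 such that D(0, μ) ≤ α for every probability measure μ on X with finite second moment (where 0 is the null measure). Then X is bounded; more precisely diam(X) ≤ 2α. Consequently, no such metric D exists when X is unbounded. -/
open MeasureTheory

noncomputable section

variable {d : ℕ}

/-- Squared 2-Wasserstein distance between measures on a subset `X ⊆ ℝ^d`,
for the cost `|x - y|²`, as an infimum over couplings. -/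
def W2sqOn (X : Set (Euc d)) (μ ν : Measure X) : ℝ :=
  sInf { r : ℝ | ∃ π : Measure (X × X),
    π.map Prod.fst = μ ∧ π.map Prod.snd = ν ∧
      r = ∫ p, dist (p.1 : Euc d) (p.2 : Euc d) ^ 2 ∂π }

/-- 2-Wasserstein distance on a subset `X ⊆ ℝ^d`. -/
def W2On (X : Set (Euc d)) (μ ν : Measure X) : ℝ := Real.sqrt (W2sqOn X μ ν)

/-- Finite positive measure on `X` with finite second moment. -/
def MemMOn (X : Set (Euc d)) (μ : Measure X) : Prop :=
  IsFiniteMeasure μ ∧ Integrable (fun x : X => ‖(x : Euc d)‖ ^ 2) μ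

/-- Probability measure on `X` with finite second moment. -/
def MemP2On (X : Set (Euc d)) (μ : Measure X) : Prop :=
  IsProbabilityMeasure μ ∧ Integrable (fun x : X => ‖(x : Euc d)‖ ^ 2) μ

/-- The only coupling cost between two Dirac masses is the squared distance of their atoms. -/
theorem W2On_dirac (X : Set (Euc d)) (x y : X) :
    W2On X (Measure.dirac x) (Measure.dirac y) = dist (x : Euc d) (y : Euc d) := by
  have hset : { r : ℝ | ∃ π : Measure (X × X),
      π.map Prod.fst = Measure.dirac x ∧ π.map Prod.snd = Measure.dirac y ∧
        r = ∫ p, dist (p.1 : Euc d) (p.2 : Euc d) ^ 2 ∂π } =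
      {dist (x : Euc d) (y : Euc d) ^ 2} := by
    ext r
    constructor
    · rintro ⟨π, h1, h2, rfl⟩
      have hπ : IsProbabilityMeasure π := by
        constructor
        have h := congrArg (fun m : Measure X => m Set.univ) h1
        simpa [Measure.map_apply measurable_fst MeasurableSet.univ] using h
      have e1 : ∀ᵐ p ∂π, p.1 = x := by
        refine ae_of_ae_map (p := fun a => a = x) measurable_fst.aemeasurable ?_
        rw [h1, ae_dirac_eq]
        rfl
      have e2 : ∀ᵐ p ∂π, p.2 = y := by
        refine ae_of_ae_map (p := fun a => a = y) measurable_snd.aemeasurable ?_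
        rw [h2, ae_dirac_eq]
        rfl
      have h : ∫ p, dist (p.1 : Euc d) (p.2 : Euc d) ^ 2 ∂π =
          ∫ _, dist (x : Euc d) (y : Euc d) ^ 2 ∂π := by
        refine integral_congr_ae ?_
        filter_upwards [e1, e2] with p hp hq
        rw [hp, hq]
      simpa using h
    · rintro rfl
      refine ⟨Measure.dirac (x, y), ?_, ?_, ?_⟩
      · exact Measure.map_dirac' measurable_fst _
      · exact Measure.map_dirac' measurable_snd _
      · rw [integral_dirac]
  rw [W2On, W2sqOn, hset, csInf_singleton, Real.sqrt_sq dist_nonneg]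

theorem memP2On_dirac (X : Set (Euc d)) (x : X) : MemP2On X (Measure.dirac x) :=
  ⟨inferInstance, integrable_dirac (by simp)⟩

theorem MemP2On.memMOn {X : Set (Euc d)} {μ : Measure X} (h : MemP2On X μ) : MemMOn X μ :=
  ⟨have := h.1; inferInstance, h.2⟩

theorem memMOn_zero (X : Set (Euc d)) : MemMOn X 0 :=
  ⟨inferInstance, integrable_zero_measure⟩

/-- impossibility of a bounded extension of `W₂`.  If `D` is a metric
on the finite positive measures on `X ⊆ ℝ^d` with finite second moment which
coincides with `W₂` on probability measures and is bounded by `α` on the distance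
from the null measure to probability measures, then `diam X ≤ 2α`; in particular
`X` is bounded, so no such metric exists when `X` is unbounded. -/
theorem no_bounded_extension (d : ℕ) (X : Set (Euc d))
    (D : Measure X → Measure X → ℝ)
    (hnonneg : ∀ μ ν, MemMOn X μ → MemMOn X ν → 0 ≤ D μ ν)
    (hsymm : ∀ μ ν, MemMOn X μ → MemMOn X ν → D μ ν = D ν μ)
    (heq : ∀ μ ν, MemMOn X μ → MemMOn X ν → (D μ ν = 0 ↔ μ = ν))
    (htri : ∀ μ ν η, MemMOn X μ → MemMOn X ν → MemMOn X η → D μ ν ≤ D μ η + D η ν)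
    (hext : ∀ μ ν, MemP2On X μ → MemP2On X ν → D μ ν = W2On X μ ν)
    (α : ℝ) (hα : 0 < α) (hbd : ∀ μ, MemP2On X μ → D 0 μ ≤ α) :
    (∀ x ∈ X, ∀ y ∈ X, dist x y ≤ 2 * α) ∧ Bornology.IsBounded X := by
  have hdist : ∀ x ∈ X, ∀ y ∈ X, dist x y ≤ 2 * α := by
    intro x hx y hy
    have px := memP2On_dirac X ⟨x, hx⟩
    have py := memP2On_dirac X ⟨y, hy⟩
    have h := htri _ _ 0 px.memMOn py.memMOn (memMOn_zero X)
    rw [hext _ _ px py, W2On_dirac, hsymm _ _ px.memMOn (memMOn_zero X)] at h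
    linarith [hbd _ px, hbd _ py]
  exact ⟨hdist, Metric.isBounded_iff.2 ⟨2 * α, fun _ hx _ hy => hdist _ hx _ hy⟩⟩

end
end

section
/- Impossibility for Entropy–Transport metrics to extend W₂: with f, c, D_f, and ET as in the Entropy–Transport setting, if min(f(0), f'_∞(1)) < +∞ then ET cannot be (the square of) a metric on the finite positive measures on ℝ^d that coincides with W₂² on probability measures with finite second moment; and if min(f(0), f'_∞(1)) = +∞, then ET(μ, 0) = +∞ for every nonzero finite positive measure μ on ℝ^d, where 0 is the null measure. -/
open MeasureTheory

noncomputable section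

variable {d : ℕ}

open ENNReal

/-- The Csiszár `f`-divergence `D_f(σ | μ) = ∫ f(dσ/dμ) dμ + f'_∞(1) · σ^⊥(ℝ^d)`,
where `σ = (dσ/dμ)·μ + σ^⊥` is the Lebesgue decomposition and `finf = f'_∞(1)`
(with the convention `∞ · 0 = 0`, built into `ℝ≥0∞`). -/
def fDiv (f : ℝ≥0∞ → ℝ≥0∞) (finf : ℝ≥0∞) (σ μ : Measure (Euc d)) : ℝ≥0∞ :=
  (∫⁻ x, f (σ.rnDeriv μ x) ∂μ) + finf * (σ.singularPart μ) Set.univ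

/-- The Entropy–Transport value: infimum over finite positive measures `γ` on
`ℝ^d × ℝ^d` of `D_f(P₀#γ | μ) + D_f(P₁#γ | ν) + ∫ c dγ`. -/
def ETval (f : ℝ≥0∞ → ℝ≥0∞) (finf : ℝ≥0∞) (c : Euc d × Euc d → ℝ≥0∞)
    (μ ν : Measure (Euc d)) : ℝ≥0∞ :=
  ⨅ γ : { γ : Measure (Euc d × Euc d) // IsFiniteMeasure γ },
    fDiv f finf ((γ : Measure (Euc d × Euc d)).map Prod.fst) μ
      + fDiv f finf ((γ : Measure (Euc d × Euc d)).map Prod.snd) ν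
      + ∫⁻ p, c p ∂(γ : Measure (Euc d × Euc d))

lemma integral_coupling_dirac (x y : Euc d) {π : Measure (Euc d × Euc d)}
    (h1 : π.map Prod.fst = Measure.dirac x) (h2 : π.map Prod.snd = Measure.dirac y) :
    ∫ p, ‖p.1 - p.2‖ ^ 2 ∂π = ‖x - y‖ ^ 2 := by
  have hfst : ∀ᵐ p ∂π, p.1 = x := by
    refine ae_of_ae_map measurable_fst.aemeasurable (p := fun z => z = x) ?_
    rw [h1, ae_dirac_eq]
    exact rfl
  have hsnd : ∀ᵐ p ∂π, p.2 = y := by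
    refine ae_of_ae_map measurable_snd.aemeasurable (p := fun z => z = y) ?_
    rw [h2, ae_dirac_eq]
    exact rfl
  have huniv : π Set.univ = 1 := by
    simpa [Measure.map_apply measurable_fst MeasurableSet.univ] using
      congrArg (fun m : Measure (Euc d) => m Set.univ) h1
  have hae : (fun p : Euc d × Euc d => ‖p.1 - p.2‖ ^ 2) =ᵐ[π] fun _ => ‖x - y‖ ^ 2 := by
    filter_upwards [hfst, hsnd] with p hp hq
    rw [hp, hq]
  rw [integral_congr_ae hae, integral_const]
  simp [measureReal_def, huniv]

lemma W2_dirac (x y : Euc d) : W2 (Measure.dirac x) (Measure.dirac y) = ‖x - y‖ := by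
  have hset : { r : ℝ | ∃ π : Measure (Euc d × Euc d),
      π.map Prod.fst = Measure.dirac x ∧ π.map Prod.snd = Measure.dirac y ∧
        r = ∫ p, ‖p.1 - p.2‖ ^ 2 ∂π } = {‖x - y‖ ^ 2} := by
    ext r
    constructor
    · rintro ⟨π, h1, h2, rfl⟩
      exact integral_coupling_dirac x y h1 h2
    · rintro rfl
      refine ⟨Measure.dirac (x, y), Measure.map_dirac' measurable_fst _,
        Measure.map_dirac' measurable_snd _, ?_⟩
      rw [integral_dirac]
  rw [W2, W2sq, hset, csInf_singleton, Real.sqrt_sq (norm_nonneg _)]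

lemma memP2_dirac (x : Euc d) : MemP2 (Measure.dirac x) :=
  ⟨inferInstance, integrable_dirac (by simp)⟩

lemma MemP2.memM {μ : Measure (Euc d)} (h : MemP2 μ) : MemM μ :=
  ⟨have := h.1; inferInstance, h.2⟩

lemma fDiv_zero_left (f : ℝ≥0∞ → ℝ≥0∞) (finf : ℝ≥0∞) (μ : Measure (Euc d)) :
    fDiv f finf 0 μ = f 0 * μ Set.univ := by
  have h : (fun x => f ((0 : Measure (Euc d)).rnDeriv μ x)) =ᵐ[μ] fun _ => f 0 := by
    filter_upwards [Measure.rnDeriv_zero μ] with x hx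
    rw [hx, Pi.zero_apply]
  rw [fDiv, lintegral_congr_ae h, lintegral_const, Measure.singularPart_zero]
  simp

lemma fDiv_zero_right (f : ℝ≥0∞ → ℝ≥0∞) (finf : ℝ≥0∞) (σ : Measure (Euc d)) :
    fDiv f finf σ 0 = finf * σ Set.univ := by
  simp [fDiv, Measure.singularPart_eq_self.2 Measure.MutuallySingular.zero_right]

lemma fDiv_add_of_mutuallySingular (f : ℝ≥0∞ → ℝ≥0∞) (hf1 : f 1 = 0) (finf : ℝ≥0∞)
    {μ ν : Measure (Euc d)} [IsFiniteMeasure μ] [IsFiniteMeasure ν]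
    (h : ν.MutuallySingular μ) :
    fDiv f finf (μ + ν) μ = finf * ν Set.univ := by
  have := h.haveLebesgueDecomposition
  have hae : (fun x => f ((μ + ν).rnDeriv μ x)) =ᵐ[μ] fun _ => 0 := by
    filter_upwards [Measure.rnDeriv_add μ ν μ, Measure.rnDeriv_self μ,
      Measure.rnDeriv_eq_zero_of_mutuallySingular h Measure.AbsolutelyContinuous.rfl]
      with x h1 h2 h3
    rw [h1, Pi.add_apply, h2, h3, Pi.zero_apply, add_zero, hf1]
  rw [fDiv, lintegral_congr_ae hae, Measure.singularPart_add, Measure.singularPart_self,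
    Measure.singularPart_eq_self.2 h]
  simp

lemma ETval_le_of_zero_plan (f : ℝ≥0∞ → ℝ≥0∞) (finf : ℝ≥0∞)
    (c : Euc d × Euc d → ℝ≥0∞) (μ ν : Measure (Euc d)) :
    ETval f finf c μ ν ≤ f 0 * μ Set.univ + f 0 * ν Set.univ := by
  refine (iInf_le _ ⟨0, inferInstance⟩).trans (le_of_eq ?_)
  simp [fDiv_zero_left]

lemma ETval_dirac_le_of_ne (f : ℝ≥0∞ → ℝ≥0∞) (hf1 : f 1 = 0) (finf : ℝ≥0∞)
    (c : Euc d × Euc d → ℝ≥0∞) (hc : ∀ x : Euc d, c (x, x) = 0) {x y : Euc d} (hxy : x ≠ y) :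
    ETval f finf c (Measure.dirac x) (Measure.dirac y) ≤ finf + finf := by
  have hsing : ∀ {a b : Euc d}, a ≠ b →
      (Measure.dirac a).MutuallySingular (Measure.dirac b) := by
    intro a b hab
    refine ⟨{b}, measurableSet_singleton b, ?_, ?_⟩ <;> simp [hab]
  refine (iInf_le _ ⟨Measure.dirac (x, x) + Measure.dirac (y, y), inferInstance⟩).trans
    (le_of_eq ?_)
  dsimp only
  rw [Measure.map_add _ _ measurable_fst, Measure.map_add _ _ measurable_snd,
    Measure.map_dirac' measurable_fst, Measure.map_dirac' measurable_fst,
    Measure.map_dirac' measurable_snd, Measure.map_dirac' measurable_snd,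
    fDiv_add_of_mutuallySingular f hf1 finf (hsing hxy.symm),
    add_comm (Measure.dirac x), fDiv_add_of_mutuallySingular f hf1 finf (hsing hxy)]
  simp [lintegral_add_measure, hc]

lemma ETval_zero_right_eq_top (f : ℝ≥0∞ → ℝ≥0∞) (finf : ℝ≥0∞) (c : Euc d × Euc d → ℝ≥0∞)
    (hf0 : f 0 = ⊤) (hfinf : finf = ⊤) {μ : Measure (Euc d)} (hμ : μ ≠ 0) :
    ETval f finf c μ 0 = ⊤ := by
  refine iInf_eq_top.2 ?_
  rintro ⟨γ, -⟩
  dsimp only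
  by_cases hγ : γ = 0
  · simp [hγ, fDiv_zero_left, hf0, ENNReal.top_mul, hμ]
  · simp [fDiv_zero_right, hfinf, Measure.map_apply measurable_snd MeasurableSet.univ,
      ENNReal.top_mul, hγ]

/-- If `min (f 0) (f'_∞(1))` is finite, the Entropy–Transport value is bounded on distinct
Dirac masses, uniformly in their distance. -/
lemma ETval_dirac_le (f : ℝ≥0∞ → ℝ≥0∞) (hf1 : f 1 = 0) (finf : ℝ≥0∞)
    (c : Euc d × Euc d → ℝ≥0∞) (hc : ∀ x : Euc d, c (x, x) = 0) {x y : Euc d} (hxy : x ≠ y) :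
    ETval f finf c (Measure.dirac x) (Measure.dirac y) ≤
      min (f 0) finf + min (f 0) finf := by
  rcases le_total (f 0) finf with h | h
  · rw [min_eq_left h]
    simpa using ETval_le_of_zero_plan f finf c (Measure.dirac x) (Measure.dirac y)
  · rw [min_eq_right h]
    exact ETval_dirac_le_of_ne f hf1 finf c hc hxy

/-- impossibility for Entropy–Transport metrics to extend `W₂`.
If `min (f 0) (f'_∞(1)) < ∞`, then there is no metric `D` on the finite positive
measures with finite second moment whose square is `ET` and which coincides with
`W₂` on probability measures; and if `min (f 0) (f'_∞(1)) = ∞`, then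
`ET(μ, 0) = ∞` for every nonzero `μ`. -/
theorem ET_cannot_extend_W2 (d : ℕ) (hd : 1 ≤ d) (f : ℝ≥0∞ → ℝ≥0∞) (hf1 : f 1 = 0)
    (hconv : ∀ p q a b : ℝ≥0∞, p + q = 1 → f (p * a + q * b) ≤ p * f a + q * f b)
    (hlsc : LowerSemicontinuous f)
    (finf : ℝ≥0∞)
    (hfinf : Filter.Tendsto (fun t : NNReal => f t / t) Filter.atTop (nhds finf))
    (c : Euc d × Euc d → ℝ≥0∞) (hclsc : LowerSemicontinuous c)
    (hcdiag : ∀ x : Euc d, c (x, x) = 0) :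
    (min (f 0) finf < ⊤ →
      ¬ ∃ D : Measure (Euc d) → Measure (Euc d) → ℝ,
        (∀ μ ν, MemM μ → MemM ν → 0 ≤ D μ ν) ∧
        (∀ μ ν, MemM μ → MemM ν → D μ ν = D ν μ) ∧
        (∀ μ ν, MemM μ → MemM ν → (D μ ν = 0 ↔ μ = ν)) ∧
        (∀ μ ν η, MemM μ → MemM ν → MemM η → D μ ν ≤ D μ η + D η ν) ∧
        (∀ μ ν, MemM μ → MemM ν → ETval f finf c μ ν = ENNReal.ofReal ((D μ ν) ^ 2)) ∧
        (∀ μ ν, MemP2 μ → MemP2 ν → D μ ν = W2 μ ν)) ∧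
    (min (f 0) finf = ⊤ →
      ∀ μ : Measure (Euc d), MemM μ → μ ≠ 0 → ETval f finf c μ 0 = ⊤) := by
  refine ⟨?_, fun htop μ _ hμ =>
    ETval_zero_right_eq_top f finf c (min_eq_top.1 htop).1 (min_eq_top.1 htop).2 hμ⟩
  rintro hfin ⟨D, -, -, -, -, hET, hW⟩
  have hC : min (f 0) finf + min (f 0) finf ≠ ⊤ := ENNReal.add_ne_top.2 ⟨hfin.ne, hfin.ne⟩
  set C := min (f 0) finf + min (f 0) finf
  have hC0 : 0 ≤ C.toReal := ENNReal.toReal_nonneg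
  let x : Euc d := EuclideanSpace.single ⟨0, hd⟩ (C.toReal + 1)
  have hnorm : ‖x - 0‖ = C.toReal + 1 := by
    rw [sub_zero, PiLp.norm_single, Real.norm_of_nonneg (by linarith)]
  have hx : x ≠ 0 := by
    intro h
    rw [h, sub_zero, norm_zero] at hnorm
    linarith
  have hle := ETval_dirac_le f hf1 finf c hcdiag hx
  rw [hET _ _ (memP2_dirac x).memM (memP2_dirac 0).memM, hW _ _ (memP2_dirac x) (memP2_dirac 0),
    W2_dirac, hnorm, ENNReal.ofReal_le_iff_le_toReal hC] at hle
  nlinarith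

end
end
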